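/- There exist constants c_γ > 0 and δ_γ > 0, depending only on L₀, C₂ and q, such that every reduced static shell with inner radius R₀ ≤ δ_γ satisfies e^{γ(r)} − 1 ≤ c_γ · r^(2/(q+1)) for all r ∈ [R₀, 5R₀]. -/

import Mathlib

open Real MeasureTheory

noncomputable section

/-- `γ(r) = -μ(r) - (1/2)·log(1 + L₀/r²)`. -/
def gam (L₀ : ℝ) (μ : ℝ → ℝ) (r : ℝ) : ℝ :=
  -μ r - (1 / 2) * Real.log (1 + L₀ / r ^ 2)

/-- Energy density `ρ(r) = C₁·max(γ(r),0)^q / r⁴`. -/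
def rho (L₀ C₁ q : ℝ) (μ : ℝ → ℝ) (r : ℝ) : ℝ :=
  C₁ * (max (gam L₀ μ r) 0) ^ q / r ^ 4

/-- Radial pressure `p(r) = C₂·max(γ(r),0)^(q+1) / r⁴`. -/
def pres (L₀ C₂ q : ℝ) (μ : ℝ → ℝ) (r : ℝ) : ℝ :=
  C₂ * (max (gam L₀ μ r) 0) ^ (q + 1) / r ^ 4

/-- `z(r) = C₃·max(γ(r),0)^q / r²`. -/
def zfun (L₀ C₃ q : ℝ) (μ : ℝ → ℝ) (r : ℝ) : ℝ :=
  C₃ * (max (gam L₀ μ r) 0) ^ q / r ^ 2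

/-- Quasi-local mass `m(r) = ∫_{R₀}^r 4π η² ρ(η) dη`. -/
def mass (R₀ L₀ C₁ q : ℝ) (μ : ℝ → ℝ) (r : ℝ) : ℝ :=
  ∫ η in R₀..r, 4 * π * η ^ 2 * rho L₀ C₁ q μ η

/-- `μ'(r) = (m/r² + 4πrp)·e^{2λ}` with `e^{-2λ} = 1 - 2m/r`. -/
def muder (R₀ L₀ C₁ C₂ q : ℝ) (μ : ℝ → ℝ) (r : ℝ) : ℝ :=
  (mass R₀ L₀ C₁ q μ r / r ^ 2 + 4 * π * r * pres L₀ C₂ q μ r) *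
    (1 - 2 * mass R₀ L₀ C₁ q μ r / r)⁻¹

/-- `γ'(r) = -μ'(r) + L₀/(r(r²+L₀))`. -/
def gamder (R₀ L₀ C₁ C₂ q : ℝ) (μ : ℝ → ℝ) (r : ℝ) : ℝ :=
  -muder R₀ L₀ C₁ C₂ q μ r + L₀ / (r * (r ^ 2 + L₀))

/-- A reduced static shell: `γ(R₀)=0`, `2m(r)/r<1` for `r ≥ R₀`, and the
field equation `μ'(r) = (m/r² + 4πrp)·(1-2m/r)⁻¹` for `r ≥ R₀`. -/
structure IsReducedShell (R₀ L₀ C₁ C₂ q : ℝ) (μ : ℝ → ℝ) : Prop where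
  inner_zero : gam L₀ μ R₀ = 0
  mass_lt : ∀ r, R₀ ≤ r → 2 * mass R₀ L₀ C₁ q μ r / r < 1
  field_eq : ∀ r, R₀ ≤ r → HasDerivAt μ (muder R₀ L₀ C₁ C₂ q μ r) r

theorem gam_hasDerivAt (R₀ L₀ C₁ C₂ q : ℝ) (μ : ℝ → ℝ) (hL : 0 < L₀) (r : ℝ) (hr : 0 < r)
    (h : HasDerivAt μ (muder R₀ L₀ C₁ C₂ q μ r) r) :
    HasDerivAt (gam L₀ μ) (gamder R₀ L₀ C₁ C₂ q μ r) r := by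
  have hpos : 0 < 1 + L₀ / r ^ 2 := by positivity
  have h1 : HasDerivAt (fun x : ℝ => 1 + L₀ / x ^ 2)
      ((0 * r ^ 2 - L₀ * (2 * r)) / (r ^ 2) ^ 2) r := by
    have h2 : HasDerivAt (fun x : ℝ => x ^ 2) (2 * r) r := by
      simpa using hasDerivAt_pow 2 r
    exact ((hasDerivAt_const r L₀).fun_div h2 (by positivity)).const_add 1
  have h3 := (h.neg).sub ((h1.log hpos.ne').const_mul (1 / 2))
  refine HasDerivAt.congr_deriv (f := gam L₀ μ) h3 ?_
  unfold gamder
  have : 0 < r ^ 2 + L₀ := by positivity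
  field_simp
  ring

theorem gam_le_barrier (R₀ L₀ C₁ C₂ q : ℝ) (μ : ℝ → ℝ) (hL : 0 < L₀) (hC₁ : 0 < C₁)
    (hC₂ : 0 < C₂) (hq : 2 ≤ q) (hR : 0 < R₀) (hS : IsReducedShell R₀ L₀ C₁ C₂ q μ)
    (r : ℝ) (hr : R₀ ≤ r) :
    gam L₀ μ r ≤ (1 / (4 * π * C₂)) ^ (1 / (q + 1)) * r ^ (2 / (q + 1)) := by
  set b : ℝ := (1 / (4 * π * C₂)) ^ (1 / (q + 1)) with hb
  have hπ := Real.pi_pos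
  have hb0 : 0 < b := by positivity
  have hg : ∀ x, R₀ ≤ x → HasDerivAt (gam L₀ μ) (gamder R₀ L₀ C₁ C₂ q μ x) x := fun x hx =>
    gam_hasDerivAt _ _ _ _ _ _ hL x (hR.trans_le hx) (hS.field_eq x hx)
  have hB : ∀ x, R₀ ≤ x → HasDerivAt (fun x : ℝ => b * x ^ (2 / (q + 1)))
      (b * ((2 / (q + 1)) * x ^ (2 / (q + 1) - 1))) x := fun x hx =>
    (Real.hasDerivAt_rpow_const (Or.inl (hR.trans_le hx).ne')).const_mul b
  refine image_le_of_deriv_right_lt_deriv_boundary' (a := R₀) (b := r)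
    (f := gam L₀ μ) (f' := gamder R₀ L₀ C₁ C₂ q μ)
    (B := fun x : ℝ => b * x ^ (2 / (q + 1)))
    (B' := fun x => b * ((2 / (q + 1)) * x ^ (2 / (q + 1) - 1)))
    (fun x hx => (hg x hx.1).continuousAt.continuousWithinAt)
    (fun x hx => (hg x hx.1).hasDerivWithinAt) ?_
    (fun x hx => (hB x hx.1).continuousAt.continuousWithinAt)
    (fun x hx => (hB x hx.1).hasDerivWithinAt) ?_ (Set.right_mem_Icc.2 hr)
  · rw [hS.inner_zero]; positivity
  · intro x hx heq
    have hx0 : 0 < x := hR.trans_le hx.1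
    have hB' : 0 < b * ((2 / (q + 1)) * x ^ (2 / (q + 1) - 1)) := by positivity
    refine lt_of_le_of_lt ?_ hB'
    have hp : 4 * π * x * pres L₀ C₂ q μ x = 1 / x := by
      have hq1 : q + 1 ≠ 0 := by linarith
      have e1 : b ^ (q + 1) = 1 / (4 * π * C₂) := by
        rw [hb, ← Real.rpow_mul (by positivity), one_div_mul_cancel hq1, Real.rpow_one]
      have e2 : (x ^ (2 / (q + 1))) ^ (q + 1) = x ^ 2 := by
        rw [← Real.rpow_mul hx0.le, div_mul_cancel₀ _ hq1]
        exact_mod_cast Real.rpow_natCast x 2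
      unfold pres
      rw [heq, max_eq_left (by positivity), Real.mul_rpow hb0.le (by positivity), e1, e2]
      field_simp
    have hm : 0 ≤ mass R₀ L₀ C₁ q μ x := by
      unfold mass
      refine intervalIntegral.integral_nonneg hx.1 fun u hu => ?_
      unfold rho
      have := Real.rpow_nonneg (le_max_right (gam L₀ μ u) 0) q
      positivity
    have hlt := hS.mass_lt x hx.1
    have hinv : 1 ≤ (1 - 2 * mass R₀ L₀ C₁ q μ x / x)⁻¹ := by
      apply (one_le_inv₀ (by linarith)).2
      have : 0 ≤ 2 * mass R₀ L₀ C₁ q μ x / x := by positivity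
      linarith
    have hmu : 1 / x ≤ muder R₀ L₀ C₁ C₂ q μ x := by
      unfold muder
      rw [hp]
      have h1 : 0 ≤ mass R₀ L₀ C₁ q μ x / x ^ 2 := by positivity
      have h2 : 0 < 1 / x := by positivity
      nlinarith
    have hl : L₀ / (x * (x ^ 2 + L₀)) ≤ 1 / x := by
      rw [div_le_div_iff₀ (by positivity) hx0]
      nlinarith [pow_pos hx0 3]
    unfold gamder
    linarith

/-- Lemma 2 of the paper. There are `c_γ > 0` and
`δ_γ > 0`, depending only on `L₀, C₂, q`, such that every reduced static
shell with inner radius `R₀ ≤ δ_γ` satisfies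
`e^{γ(r)} - 1 ≤ c_γ · r^(2/(q+1))` for all `r ∈ [R₀, 5R₀]`. -/
theorem gamma_small_for_small_radius (L₀ C₂ q : ℝ)
    (hL₀ : 0 < L₀) (hC₂ : 0 < C₂) (hq : 2 ≤ q) :
    ∃ cγ δγ : ℝ, 0 < cγ ∧ 0 < δγ ∧
      ∀ (C₁ R₀ : ℝ) (μ : ℝ → ℝ), 0 < C₁ → 0 < R₀ → R₀ ≤ δγ →
        IsReducedShell R₀ L₀ C₁ C₂ q μ →
        ∀ r ∈ Set.Icc R₀ (5 * R₀),
          Real.exp (gam L₀ μ r) - 1 ≤ cγ * r ^ (2 / (q + 1)) := by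
  have hπ := Real.pi_pos
  set b : ℝ := (1 / (4 * π * C₂)) ^ (1 / (q + 1)) with hb
  have hb0 : 0 < b := by positivity
  refine ⟨b * Real.exp b, 1 / 5, by positivity, by norm_num, ?_⟩
  intro C₁ R₀ μ hC₁ hR hRδ hS r hr
  have hr0 : 0 < r := hR.trans_le hr.1
  have hr1 : r ≤ 1 := by linarith [hr.2]
  have hle := gam_le_barrier R₀ L₀ C₁ C₂ q μ hL₀ hC₁ hC₂ hq hR hS r hr.1
  rw [← hb] at hle
  set t := r ^ (2 / (q + 1)) with ht
  have ht0 : 0 < t := by positivity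
  have ht1 : t ≤ 1 := Real.rpow_le_one hr0.le hr1 (by positivity)
  have hbt : b * t ≤ b := by nlinarith
  have h1 : Real.exp (gam L₀ μ r) ≤ Real.exp (b * t) := Real.exp_le_exp.2 hle
  have h2 : Real.exp (b * t) ≤ Real.exp b := Real.exp_le_exp.2 hbt
  have h3 : Real.exp (b * t) - 1 ≤ b * t * Real.exp (b * t) := by
    have h4 := Real.add_one_le_exp (-(b * t))
    have h5 : Real.exp (-(b * t)) * Real.exp (b * t) = 1 := by
      rw [← Real.exp_add]; simp
    nlinarith [Real.exp_pos (b * t)]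
  have h6 : b * t * Real.exp (b * t) ≤ b * t * Real.exp b :=
    mul_le_mul_of_nonneg_left h2 (by positivity)
  nlinarith

end
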